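/- arXiv:2106.06097 — 4 statements merged into one kernel-verified Lean document; each statement's English description precedes it below -/
import Mathlib

section
/- Let W be a real d×N matrix with (1/N) W Wᵀ = I_d, fix x ∈ ℝ^d, and let φ : ℝ^N → ℝ. Given y_t ∈ ℝ^N, set a_{t+1} := Wᵀ x + (I_N − (1/N) Wᵀ W) y_t and let y_{t+1} ∈ ℝ^N minimize y ↦ ½ ‖y − a_{t+1}‖₂² + φ(y) over ℝ^N. Define Q̂(y) := ½ ‖x − (1/N) W y‖₂² + (1/N) φ(y). Then (monotonic descent): Q̂(y_{t+1}) ≤ Q̂(y_t) − (1/(2N)) ‖(I_N − (1/N) Wᵀ W)(y_{t+1} − y_t)‖₂² ≤ Q̂(y_t). -/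
open Matrix

/-- The finite objective `Q̂(y) = ½‖x − (1/N) W y‖² + (1/N) φ(y)`. -/
noncomputable def Qhat {d N : ℕ} (W : Matrix (Fin d) (Fin N) ℝ)
    (x : EuclideanSpace ℝ (Fin d)) (φ : EuclideanSpace ℝ (Fin N) → ℝ)
    (y : EuclideanSpace ℝ (Fin N)) : ℝ :=
  (1/2) * ‖x - (N : ℝ)⁻¹ • Matrix.toEuclideanLin W y‖^2 + (N : ℝ)⁻¹ * φ y

theorem inner_toEuclideanLin_transpose {d N : ℕ} (W : Matrix (Fin d) (Fin N) ℝ)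
    (r : EuclideanSpace ℝ (Fin N)) (u : EuclideanSpace ℝ (Fin d)) :
    inner ℝ r (Matrix.toEuclideanLin Wᵀ u) = inner ℝ (Matrix.toEuclideanLin W r) u := by
  rw [← Matrix.conjTranspose_eq_transpose_of_trivial,
    Matrix.toEuclideanLin_conjTranspose_eq_adjoint, LinearMap.adjoint_inner_right]

/-- The proximal objective splits into `N * Qhat` and a penalty along the kernel of `W`. -/
theorem prox_objective_eq {d N : ℕ} (hN : (N : ℝ) ≠ 0) (W : Matrix (Fin d) (Fin N) ℝ)
    (hW : (N : ℝ)⁻¹ • (W * Wᵀ) = 1)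
    (x : EuclideanSpace ℝ (Fin d)) (φ : EuclideanSpace ℝ (Fin N) → ℝ)
    (y z : EuclideanSpace ℝ (Fin N)) :
    (1/2) * ‖y - (Matrix.toEuclideanLin Wᵀ x
        + Matrix.toEuclideanLin (1 - (N : ℝ)⁻¹ • (Wᵀ * W)) z)‖^2 + φ y
      = N * Qhat W x φ y
        + (1/2) * ‖Matrix.toEuclideanLin (1 - (N : ℝ)⁻¹ • (Wᵀ * W)) (y - z)‖^2 := by
  have hP (v : EuclideanSpace ℝ (Fin N)) :
      Matrix.toEuclideanLin (1 - (N : ℝ)⁻¹ • (Wᵀ * W)) v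
        = v - (N : ℝ)⁻¹ • Matrix.toEuclideanLin Wᵀ (Matrix.toEuclideanLin W v) := by
    ext i
    simp [Matrix.toLpLin_apply, Matrix.mulVec_mulVec]
  have hWW (u : EuclideanSpace ℝ (Fin d)) :
      Matrix.toEuclideanLin W (Matrix.toEuclideanLin Wᵀ u) = (N : ℝ) • u := by
    have h : W * Wᵀ = (N : ℝ) • (1 : Matrix (Fin d) (Fin d) ℝ) := by
      rw [← hW, smul_smul, mul_inv_cancel₀ hN, one_smul]
    ext i
    simp [Matrix.toLpLin_apply, Matrix.mulVec_mulVec, h, Matrix.smul_mulVec]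
  set r := Matrix.toEuclideanLin (1 - (N : ℝ)⁻¹ • (Wᵀ * W)) (y - z) with hr
  set u := x - (N : ℝ)⁻¹ • Matrix.toEuclideanLin W y with hu
  have hsplit : y - (Matrix.toEuclideanLin Wᵀ x
      + Matrix.toEuclideanLin (1 - (N : ℝ)⁻¹ • (Wᵀ * W)) z)
      = r - Matrix.toEuclideanLin Wᵀ u := by
    rw [hr, hu, hP, hP]
    simp only [map_sub, map_smul, smul_sub]
    abel
  have hWr : Matrix.toEuclideanLin W r = 0 := by
    rw [hr, hP, map_sub, map_smul, hWW, smul_smul, inv_mul_cancel₀ hN, one_smul, sub_self]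
  have horth : inner ℝ r (Matrix.toEuclideanLin Wᵀ u) = 0 := by
    rw [inner_toEuclideanLin_transpose, hWr, inner_zero_left]
  have hnorm : ‖Matrix.toEuclideanLin Wᵀ u‖^2 = N * ‖u‖^2 := by
    rw [← real_inner_self_eq_norm_sq, inner_toEuclideanLin_transpose, hWW, real_inner_smul_left,
      real_inner_self_eq_norm_sq]
  rw [hsplit, norm_sub_sq_real, horth, hnorm, Qhat, ← hu]
  field_simp
  ring

/-- **Monotonic descent** for the finite proximal iteration with a possibly non-convex
regularizer `φ`:
`Q̂(y_{t+1}) ≤ Q̂(y_t) − (1/(2N))‖(I − (1/N)WᵀW)(y_{t+1} − y_t)‖² ≤ Q̂(y_t)`. -/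
theorem finite_monotonic_descent {d N : ℕ} (W : Matrix (Fin d) (Fin N) ℝ)
    (hW : (N : ℝ)⁻¹ • (W * Wᵀ) = 1)
    (x : EuclideanSpace ℝ (Fin d)) (φ : EuclideanSpace ℝ (Fin N) → ℝ)
    (yt yt1 at1 : EuclideanSpace ℝ (Fin N))
    (ha : at1 = Matrix.toEuclideanLin Wᵀ x
        + Matrix.toEuclideanLin (1 - (N : ℝ)⁻¹ • (Wᵀ * W)) yt)
    (hprox : ∀ y : EuclideanSpace ℝ (Fin N),
      (1/2) * ‖yt1 - at1‖^2 + φ yt1 ≤ (1/2) * ‖y - at1‖^2 + φ y) :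
    Qhat W x φ yt1
      ≤ Qhat W x φ yt
        - (2 * (N : ℝ))⁻¹ * ‖Matrix.toEuclideanLin (1 - (N : ℝ)⁻¹ • (Wᵀ * W)) (yt1 - yt)‖^2 ∧
    Qhat W x φ yt
        - (2 * (N : ℝ))⁻¹ * ‖Matrix.toEuclideanLin (1 - (N : ℝ)⁻¹ • (Wᵀ * W)) (yt1 - yt)‖^2
      ≤ Qhat W x φ yt := by
  refine ⟨?_, sub_le_self _ (by positivity)⟩
  rcases eq_or_ne (N : ℝ) 0 with hN | hN
  · simp [Qhat, hN]
  have h := hprox yt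
  rw [ha, prox_objective_eq hN W hW, prox_objective_eq hN W hW, sub_self, map_zero, norm_zero] at h
  have hpos : 0 < (N : ℝ) := lt_of_le_of_ne N.cast_nonneg hN.symm
  refine le_of_mul_le_mul_left ?_ hpos
  rw [mul_sub, ← mul_assoc (N : ℝ) (2 * (N : ℝ))⁻¹,
    show (N : ℝ) * (2 * (N : ℝ))⁻¹ = 1 / 2 by field_simp]
  linarith
end

section
/- Let W be a real d×N matrix with (1/N) W Wᵀ = I_d, fix x ∈ ℝ^d, and let φ : ℝ^N → ℝ be convex. Given y_t ∈ ℝ^N, set a_{t+1} := Wᵀ x + (I_N − (1/N) Wᵀ W) y_t and let y_{t+1} ∈ ℝ^N minimize y ↦ ½ ‖y − a_{t+1}‖₂² + φ(y) over ℝ^N. Define Q̂(y) := ½ ‖x − (1/N) W y‖₂² + (1/N) φ(y). Then for every z ∈ ℝ^N: Q̂(y_{t+1}) ≤ Q̂(z) + (1/(2N)) ( ‖y_t − z‖₂² − ‖y_{t+1} − z‖₂² ) − ½ ‖(1/N) W (z − y_t)‖₂². -/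
open Matrix

/-- A minimizer of `½‖· − a‖² + φ` with `φ` convex satisfies the quadratic growth inequality. -/
theorem prox_quadratic_growth {E : Type*} [NormedAddCommGroup E] [InnerProductSpace ℝ E]
    {φ : E → ℝ} (hφ : ConvexOn ℝ Set.univ φ) {a p : E}
    (hp : ∀ y : E, (1/2) * ‖p - a‖^2 + φ p ≤ (1/2) * ‖y - a‖^2 + φ y) (z : E) :
    (1/2) * ‖p - a‖^2 + φ p + (1/2) * ‖z - p‖^2 ≤ (1/2) * ‖z - a‖^2 + φ z := by
  have hz : ‖z - a‖^2 = ‖p - a‖^2 + 2 * inner ℝ (p - a) (z - p) + ‖z - p‖^2 := by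
    rw [← norm_add_sq_real]; congr 2; abel
  have key : ∀ t : ℝ, 0 < t → t ≤ 1 →
      0 ≤ (φ z - φ p + inner ℝ (p - a) (z - p)) + t / 2 * ‖z - p‖^2 := by
    intro t ht ht1
    have h1 := hp ((1 - t) • p + t • z)
    have h2 := hφ.2 (Set.mem_univ p) (Set.mem_univ z) (sub_nonneg.2 ht1) ht.le (by ring)
    have h3 : ‖(1 - t) • p + t • z - a‖^2
        = ‖p - a‖^2 + 2 * (t * inner ℝ (p - a) (z - p)) + t^2 * ‖z - p‖^2 := by
      have : (1 - t) • p + t • z - a = (p - a) + t • (z - p) := by module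
      rw [this, norm_add_sq_real, inner_smul_right, norm_smul, mul_pow, Real.norm_eq_abs, sq_abs]
    rw [h3] at h1
    simp only [smul_eq_mul] at h2
    refine (mul_nonneg_iff_of_pos_left ht).1 ?_
    nlinarith
  have hD : 0 ≤ φ z - φ p + inner ℝ (p - a) (z - p) := by
    by_contra! hneg
    set D := φ z - φ p + inner ℝ (p - a) (z - p)
    have hK : 0 ≤ ‖z - p‖^2 := by positivity
    set K := ‖z - p‖^2
    have hpos : 0 < K - D := by linarith
    have h := key (-D / (K - D)) (div_pos (by linarith) hpos)
      ((div_le_one hpos).2 (by linarith))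
    have h4 : (D + -D / (K - D) / 2 * K) * (K - D) = D * (K / 2 - D) := by
      field_simp; ring
    have h5 := mul_nonneg h hpos.le
    rw [h4] at h5
    nlinarith
  rw [hz]
  linarith

theorem inner_toEuclideanLin_left {m n : ℕ} (W : Matrix (Fin m) (Fin n) ℝ)
    (v : EuclideanSpace ℝ (Fin n)) (u : EuclideanSpace ℝ (Fin m)) :
    inner ℝ (Matrix.toEuclideanLin W v) u = inner ℝ v (Matrix.toEuclideanLin Wᵀ u) := by
  rw [← Matrix.conjTranspose_eq_transpose_of_trivial,
    Matrix.toEuclideanLin_conjTranspose_eq_adjoint, LinearMap.adjoint_inner_right]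

theorem toEuclideanLin_mul_apply {l m n : ℕ} (A : Matrix (Fin l) (Fin m) ℝ)
    (B : Matrix (Fin m) (Fin n) ℝ) (v : EuclideanSpace ℝ (Fin n)) :
    Matrix.toEuclideanLin (A * B) v
      = Matrix.toEuclideanLin A (Matrix.toEuclideanLin B v) := by
  simp [Matrix.toLpLin_apply, Matrix.mulVec_mulVec]

theorem toEuclideanLin_one_apply {n : ℕ} (v : EuclideanSpace ℝ (Fin n)) :
    Matrix.toEuclideanLin (1 : Matrix (Fin n) (Fin n) ℝ) v = v := by
  simp

/-- If `c W Wᵀ = 1`, then `√c W` is a contraction. -/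
theorem norm_smul_toEuclideanLin_sq_le {d N : ℕ} {W : Matrix (Fin d) (Fin N) ℝ} {c : ℝ}
    (hc : 0 ≤ c) (hW : c • (W * Wᵀ) = 1) (v : EuclideanSpace ℝ (Fin N)) :
    ‖c • Matrix.toEuclideanLin W v‖^2 ≤ c * ‖v‖^2 := by
  have hBB : ∀ u, c * ‖Matrix.toEuclideanLin Wᵀ u‖^2 = ‖u‖^2 := by
    intro u
    have h : c • Matrix.toEuclideanLin W (Matrix.toEuclideanLin Wᵀ u) = u := by
      rw [← toEuclideanLin_mul_apply, ← LinearMap.smul_apply, ← map_smul, hW,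
        toEuclideanLin_one_apply]
    rw [← real_inner_self_eq_norm_sq, ← inner_toEuclideanLin_left, ← real_inner_smul_left, h,
      real_inner_self_eq_norm_sq]
  have h0 : 0 ≤ ‖v - c • Matrix.toEuclideanLin Wᵀ (Matrix.toEuclideanLin W v)‖^2 := by positivity
  rw [norm_sub_sq_real, inner_smul_right, ← inner_toEuclideanLin_left,
    real_inner_self_eq_norm_sq, norm_smul, mul_pow, Real.norm_eq_abs, sq_abs] at h0
  have h1 := hBB (Matrix.toEuclideanLin W v)
  rw [norm_smul, mul_pow, Real.norm_eq_abs, sq_abs]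
  have h2 : c^2 * ‖Matrix.toEuclideanLin Wᵀ (Matrix.toEuclideanLin W v)‖^2
      = c * ‖Matrix.toEuclideanLin W v‖^2 := by rw [← h1]; ring
  rw [h2] at h0
  nlinarith [mul_nonneg hc h0]

/-- One-step inequality for the finite proximal iteration with a convex regularizer:
for every `z`,
`Q̂(y_{t+1}) ≤ Q̂(z) + (1/(2N))(‖y_t − z‖² − ‖y_{t+1} − z‖²) − ½‖(1/N)W(z − y_t)‖²`. -/
theorem finite_convex_one_step {d N : ℕ} (W : Matrix (Fin d) (Fin N) ℝ)
    (hW : (N : ℝ)⁻¹ • (W * Wᵀ) = 1)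
    (x : EuclideanSpace ℝ (Fin d)) (φ : EuclideanSpace ℝ (Fin N) → ℝ)
    (hφ : ConvexOn ℝ Set.univ φ)
    (yt yt1 at1 : EuclideanSpace ℝ (Fin N))
    (ha : at1 = Matrix.toEuclideanLin Wᵀ x
        + Matrix.toEuclideanLin (1 - (N : ℝ)⁻¹ • (Wᵀ * W)) yt)
    (hprox : ∀ y : EuclideanSpace ℝ (Fin N),
      (1/2) * ‖yt1 - at1‖^2 + φ yt1 ≤ (1/2) * ‖y - at1‖^2 + φ y)
    (z : EuclideanSpace ℝ (Fin N)) :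
    Qhat W x φ yt1
      ≤ Qhat W x φ z
        + (2 * (N : ℝ))⁻¹ * (‖yt - z‖^2 - ‖yt1 - z‖^2)
        - (1/2) * ‖(N : ℝ)⁻¹ • Matrix.toEuclideanLin W (z - yt)‖^2 := by
  set c : ℝ := (N : ℝ)⁻¹ with hc
  have hc0 : 0 ≤ c := by positivity
  have h2N : (2 * (N : ℝ))⁻¹ = c / 2 := by rw [mul_inv, hc]; ring
  set r := x - c • Matrix.toEuclideanLin W yt with hr
  have ha' : at1 = yt + Matrix.toEuclideanLin Wᵀ r := by
    rw [ha, hr, map_sub, map_smul, map_sub, map_smul, LinearMap.sub_apply, LinearMap.smul_apply,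
      toEuclideanLin_mul_apply, toEuclideanLin_one_apply]
    abel
  have hdist : ∀ y, ‖y - at1‖^2 = ‖y - yt‖^2
      - 2 * inner ℝ (Matrix.toEuclideanLin W (y - yt)) r
      + ‖Matrix.toEuclideanLin Wᵀ r‖^2 := by
    intro y
    rw [ha', ← sub_sub, norm_sub_sq_real, inner_toEuclideanLin_left]
  have hres : ∀ y, ‖x - c • Matrix.toEuclideanLin W y‖^2 = ‖r‖^2
      - 2 * (c * inner ℝ (Matrix.toEuclideanLin W (y - yt)) r)
      + ‖c • Matrix.toEuclideanLin W (y - yt)‖^2 := by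
    intro y
    have : x - c • Matrix.toEuclideanLin W y
        = r - c • Matrix.toEuclideanLin W (y - yt) := by
      rw [hr, map_sub]; module
    rw [this, norm_sub_sq_real, inner_smul_right, real_inner_comm]
  have hgrow := mul_le_mul_of_nonneg_left (prox_quadratic_growth hφ hprox z) hc0
  have hcontr := norm_smul_toEuclideanLin_sq_le hc0 hW (yt1 - yt)
  rw [hdist, hdist] at hgrow
  simp only [Qhat, ← hc]
  rw [hres yt1, hres z, h2N, norm_sub_rev yt z, norm_sub_rev yt1 z]
  linarith
end

section
/- Let W be a real d×N matrix with (1/N) W Wᵀ = I_d, fix x ∈ ℝ^d, and let φ : ℝ^N → ℝ be convex. Given y_t ∈ ℝ^N, set a_{t+1} := Wᵀ x + (I_N − (1/N) Wᵀ W) y_t and let y_{t+1} ∈ ℝ^N minimize y ↦ ½ ‖y − a_{t+1}‖₂² + φ(y) over ℝ^N. Define Q̂(y) := ½ ‖x − (1/N) W y‖₂² + (1/N) φ(y). Then (strictly monotonic descent): Q̂(y_{t+1}) ≤ Q̂(y_t) − (1/(2N)) ‖y_{t+1} − y_t‖₂². -/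
open Matrix

/-- First-order optimality condition for the proximal operator of a convex function. -/
theorem inner_le_sub_of_prox {E : Type*} [NormedAddCommGroup E] [InnerProductSpace ℝ E]
    {φ : E → ℝ} (hφ : ConvexOn ℝ Set.univ φ) {a z : E}
    (hz : ∀ y : E, (1/2) * ‖z - a‖^2 + φ z ≤ (1/2) * ‖y - a‖^2 + φ y) (u : E) :
    inner ℝ (a - z) (u - z) ≤ φ u - φ z := by
  have key : ∀ t : ℝ, 0 < t → t ≤ 1 →
      inner ℝ (a - z) (u - z) ≤ φ u - φ z + t * ((1/2) * ‖u - z‖^2) := by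
    intro t ht ht1
    have hc := hφ.2 (Set.mem_univ z) (Set.mem_univ u) (sub_nonneg.2 ht1) ht.le (by ring)
    have hp := hz ((1 - t) • z + t • u)
    have e : (1 - t) • z + t • u - a = t • (u - z) - (a - z) := by module
    have e' : z - a = -(a - z) := by abel
    rw [e, e', norm_neg, norm_sub_sq_real (t • (u - z)), norm_smul, Real.norm_of_nonneg ht.le,
      real_inner_smul_left, real_inner_comm (a - z)] at hp
    simp only [smul_eq_mul] at hc
    refine le_of_mul_le_mul_left ?_ ht
    nlinarith
  have lim : Filter.Tendsto (fun t : ℝ => φ u - φ z + t * ((1/2) * ‖u - z‖^2))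
      (nhdsWithin 0 (Set.Ioi 0)) (nhds (φ u - φ z)) := by
    have hcont : Continuous fun t : ℝ => φ u - φ z + t * ((1/2) * ‖u - z‖^2) := by fun_prop
    simpa using (hcont.tendsto 0).mono_left nhdsWithin_le_nhds
  refine ge_of_tendsto lim ?_
  filter_upwards [Ioc_mem_nhdsGT (zero_lt_one' ℝ)] with t ht using key t ht.1 ht.2

/-- If `c A Aᵀ = 1` with `c ≥ 0`, then `c ‖A v‖² ≤ ‖v‖²`. -/
theorem mul_norm_sq_le_of_coisometry {E F : Type*} [NormedAddCommGroup E] [InnerProductSpace ℝ E]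
    [NormedAddCommGroup F] [InnerProductSpace ℝ F] {A : E →ₗ[ℝ] F} {B : F →ₗ[ℝ] E} {c : ℝ}
    (hadj : ∀ v w, inner ℝ (A v) w = inner ℝ v (B w)) (hAB : ∀ w, c • A (B w) = w) (v : E) :
    c * ‖A v‖^2 ≤ ‖v‖^2 := by
  have h := sq_nonneg ‖v - c • B (A v)‖
  have hB : c * ‖B (A v)‖^2 = ‖A v‖^2 := by
    rw [← real_inner_self_eq_norm_sq, ← hadj, ← real_inner_smul_left, hAB,
      real_inner_self_eq_norm_sq]
  rw [norm_sub_sq_real, real_inner_smul_right, ← hadj, real_inner_self_eq_norm_sq, norm_smul,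
    mul_pow, Real.norm_eq_abs, sq_abs, pow_two c, mul_assoc, hB] at h
  linarith

/-- **Strictly monotonic descent** for the finite proximal iteration with a convex
regularizer: `Q̂(y_{t+1}) ≤ Q̂(y_t) − (1/(2N))‖y_{t+1} − y_t‖²`. -/
theorem finite_convex_strict_descent {d N : ℕ} (W : Matrix (Fin d) (Fin N) ℝ)
    (hW : (N : ℝ)⁻¹ • (W * Wᵀ) = 1)
    (x : EuclideanSpace ℝ (Fin d)) (φ : EuclideanSpace ℝ (Fin N) → ℝ)
    (hφ : ConvexOn ℝ Set.univ φ)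
    (yt yt1 at1 : EuclideanSpace ℝ (Fin N))
    (ha : at1 = Matrix.toEuclideanLin Wᵀ x
        + Matrix.toEuclideanLin (1 - (N : ℝ)⁻¹ • (Wᵀ * W)) yt)
    (hprox : ∀ y : EuclideanSpace ℝ (Fin N),
      (1/2) * ‖yt1 - at1‖^2 + φ yt1 ≤ (1/2) * ‖y - at1‖^2 + φ y) :
    Qhat W x φ yt1 ≤ Qhat W x φ yt - (2 * (N : ℝ))⁻¹ * ‖yt1 - yt‖^2 := by
  rcases Nat.eq_zero_or_pos N with rfl | hN
  · simp [Qhat]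
  have hadj : ∀ v w, inner ℝ (Matrix.toEuclideanLin W v) w
      = inner ℝ v (Matrix.toEuclideanLin Wᵀ w) := by
    intro v w
    rw [← Matrix.conjTranspose_eq_transpose_of_trivial,
      Matrix.toEuclideanLin_conjTranspose_eq_adjoint, LinearMap.adjoint_inner_right]
  have hAB : ∀ w, (N : ℝ)⁻¹ • Matrix.toEuclideanLin W (Matrix.toEuclideanLin Wᵀ w) = w := by
    intro w
    have := congrArg (fun M => Matrix.toEuclideanLin M w) hW
    simpa [Matrix.toLpLin_mul_same] using this
  have hstep : at1 = yt + Matrix.toEuclideanLin Wᵀ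
      (x - (N : ℝ)⁻¹ • Matrix.toEuclideanLin W yt) := by
    rw [ha]
    simp only [map_sub, map_smul, LinearMap.sub_apply, LinearMap.smul_apply,
      Matrix.toLpLin_mul_same, Matrix.toLpLin_one, LinearMap.comp_apply, LinearMap.id_apply]
    abel
  have hopt := inner_le_sub_of_prox hφ hprox yt
  have hbound := mul_norm_sq_le_of_coisometry hadj hAB (yt1 - yt)
  set r := x - (N : ℝ)⁻¹ • Matrix.toEuclideanLin W yt with hr
  set δ := yt1 - yt with hδ
  have hres : x - (N : ℝ)⁻¹ • Matrix.toEuclideanLin W yt1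
      = r - (N : ℝ)⁻¹ • Matrix.toEuclideanLin W δ := by
    rw [hr, hδ, map_sub]
    module
  have hinner : inner ℝ (at1 - yt1) (yt - yt1)
      = ‖δ‖^2 - inner ℝ r (Matrix.toEuclideanLin W δ) := by
    have e₁ : at1 - yt1 = Matrix.toEuclideanLin Wᵀ r - δ := by rw [hstep, hδ]; abel
    have e₂ : yt - yt1 = -δ := by rw [hδ]; abel
    rw [e₁, e₂, inner_neg_right, inner_sub_left, real_inner_self_eq_norm_sq,
      real_inner_comm, ← hadj, real_inner_comm]
    ring
  have hc : 0 < (N : ℝ)⁻¹ := by positivity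
  rw [hinner] at hopt
  unfold Qhat
  rw [hres, ← hr, norm_sub_sq_real, real_inner_smul_right, norm_smul, mul_pow,
    Real.norm_of_nonneg hc.le, mul_inv]
  have h₁ := mul_le_mul_of_nonneg_left hopt hc.le
  have h₂ := mul_le_mul_of_nonneg_left hbound hc.le
  linarith
end

section
/- Let m, n, k be positive integers and let D be a real d×N matrix whose columns d_1, …, d_N all satisfy ‖d_j‖₂² = m/n and whose mutual coherence satisfies μ(D) ≤ √n / m (equivalently |⟨d_i, d_j⟩| ≤ 1/√n for i ≠ j). Fix x ∈ ℝ^d and define L(y) := ½ ‖x − D y‖₂². Let y_t ∈ ℝ^N be k-sparse, set a_{t+1} := Dᵀ x + (I_N − Dᵀ D) y_t, and let y_{t+1} ∈ ℝ^N be a best k-sparse approximation of a_{t+1}, i.e., y_{t+1} is k-sparse and ‖y_{t+1} − a_{t+1}‖₂ ≤ ‖y − a_{t+1}‖₂ for every k-sparse y ∈ ℝ^N. Then: L(y_{t+1}) ≤ L(y_t) + ½ ‖y_{t+1} − a_{t+1}‖₂² − ½ ‖y_t − a_{t+1}‖₂² − (n − (2k−1)√n − m)/(2n) · ‖y_{t+1}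 − y_t‖₂²; in particular, if additionally (2k−1)√n + m ≤ n, then L(y_{t+1}) ≤ L(y_t) (monotonic descent). -/
open Matrix

/-- Cauchy–Schwarz on the support: the squared `ℓ¹` norm of a sparse vector is at most its sparsity
times its squared `ℓ²` norm. -/
theorem sq_sum_abs_le_card_support_mul {ι : Type*} [Fintype ι] (v : ι → ℝ) :
    (∑ i, |v i|) ^ 2 ≤ ((Finset.univ.filter fun i => v i ≠ 0).card : ℝ) * ∑ i, v i ^ 2 := by
  have h1 : ∑ i ∈ Finset.univ.filter (fun i => v i ≠ 0), |v i| = ∑ i, |v i| :=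
    Finset.sum_filter_of_ne fun i _ h => abs_ne_zero.mp h
  have h2 : ∑ i ∈ Finset.univ.filter (fun i => v i ≠ 0), |v i| ^ 2 = ∑ i, v i ^ 2 := by
    simp only [sq_abs]
    exact Finset.sum_filter_of_ne fun i _ h => by simpa using h
  rw [← h1, ← h2]
  exact sq_sum_le_card_mul_sum_sq

/-- The support of a difference has at most as many elements as the two supports together. -/
theorem card_support_sub_le {ι : Type*} [Fintype ι] (u v : ι → ℝ) :
    (Finset.univ.filter fun i => u i - v i ≠ 0).card ≤
      (Finset.univ.filter fun i => u i ≠ 0).card + (Finset.univ.filter fun i => v i ≠ 0).card := by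
  classical
  refine le_trans (Finset.card_le_card fun i hi => ?_) (Finset.card_union_le _ _)
  simp only [Finset.mem_filter, Finset.mem_union, Finset.mem_univ, true_and] at hi ⊢
  by_contra! h
  exact hi (by rw [h.1, h.2, sub_zero])

/-- A quadratic form with constant diagonal `α` and off-diagonal entries bounded by `β` is bounded
in terms of the `ℓ²` and `ℓ¹` norms. -/
theorem sum_sum_mul_le_of_offDiag_le {ι : Type*} [Fintype ι] [DecidableEq ι]
    (G : ι → ι → ℝ) {α β : ℝ} (hdiag : ∀ i, G i i = α) (hoff : ∀ i j, i ≠ j → |G i j| ≤ β)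
    (v : ι → ℝ) :
    ∑ i, ∑ j, v i * v j * G i j ≤ (α - β) * ∑ i, v i ^ 2 + β * (∑ i, |v i|) ^ 2 := by
  have hR : (α - β) * ∑ i, v i ^ 2 + β * (∑ i, |v i|) ^ 2 =
      ∑ i, ∑ j, ((if i = j then (α - β) * v i ^ 2 else 0) + β * (|v i| * |v j|)) := by
    rw [sq (∑ i, |v i|), Finset.sum_mul_sum]
    simp [Finset.sum_add_distrib, Finset.mul_sum]
  rw [hR]
  refine Finset.sum_le_sum fun i _ => Finset.sum_le_sum fun j _ => ?_
  split_ifs with h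
  · subst h
    rw [hdiag, abs_mul_abs_self]
    linarith
  · calc v i * v j * G i j ≤ |v i * v j * G i j| := le_abs_self _
      _ = |v i| * |v j| * |G i j| := by rw [abs_mul, abs_mul]
      _ ≤ |v i| * |v j| * β := by gcongr; exact hoff i j h
      _ = 0 + β * (|v i| * |v j|) := by ring

/-- Upper restricted-isometry bound from coherence, for vectors with at most `s` nonzero entries. -/
theorem norm_sq_toEuclideanLin_le_of_coherence {d N : ℕ} (D : Matrix (Fin d) (Fin N) ℝ)
    {α β : ℝ} (hβ : 0 ≤ β) (hcol : ∀ j, ∑ i, D i j ^ 2 = α)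
    (hcoh : ∀ j j', j ≠ j' → |∑ i, D i j * D i j'| ≤ β) {s : ℕ} (v : EuclideanSpace ℝ (Fin N))
    (hv : (Finset.univ.filter fun i => v i ≠ 0).card ≤ s) :
    ‖Matrix.toEuclideanLin D v‖ ^ 2 ≤ (α + (s - 1) * β) * ‖v‖ ^ 2 := by
  have hexp : ‖Matrix.toEuclideanLin D v‖ ^ 2 =
      ∑ j, ∑ j', v j * v j' * ∑ i, D i j * D i j' := by
    rw [EuclideanSpace.real_norm_sq_eq]
    simp only [Matrix.toLpLin_apply, Matrix.mulVec, dotProduct, sq, Finset.sum_mul_sum]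
    simp only [Finset.mul_sum]
    rw [Finset.sum_comm]
    refine Finset.sum_congr rfl fun j _ => ?_
    rw [Finset.sum_comm]
    exact Finset.sum_congr rfl fun j' _ => Finset.sum_congr rfl fun i _ => by ring
  have hform := sum_sum_mul_le_of_offDiag_le (fun j j' => ∑ i, D i j * D i j')
    (fun j => by simpa only [sq] using hcol j) hcoh v
  have hl1 : (∑ i, |v i|) ^ 2 ≤ s * ∑ i, v i ^ 2 :=
    (sq_sum_abs_le_card_support_mul v).trans <|
      mul_le_mul_of_nonneg_right (Nat.cast_le.mpr hv) (Finset.sum_nonneg fun i _ => sq_nonneg _)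
  rw [hexp, EuclideanSpace.real_norm_sq_eq]
  linarith [mul_le_mul_of_nonneg_left hl1 hβ]

/-- The least-squares loss at `z`, expanded around `y`, in terms of distances to the gradient step
`y + Dᵀ(x - Dy)`. -/
theorem half_norm_sq_residual_eq {d N : ℕ} (D : Matrix (Fin d) (Fin N) ℝ)
    (x : EuclideanSpace ℝ (Fin d)) (y z a : EuclideanSpace ℝ (Fin N))
    (ha : a = Matrix.toEuclideanLin Dᵀ x + Matrix.toEuclideanLin (1 - Dᵀ * D) y) :
    (1/2) * ‖x - Matrix.toEuclideanLin D z‖ ^ 2 =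
      (1/2) * ‖x - Matrix.toEuclideanLin D y‖ ^ 2 + (1/2) * ‖z - a‖ ^ 2 - (1/2) * ‖y - a‖ ^ 2
        - (1/2) * ‖z - y‖ ^ 2 + (1/2) * ‖Matrix.toEuclideanLin D (z - y)‖ ^ 2 := by
  set g := x - Matrix.toEuclideanLin D y with hg
  set p := Matrix.toEuclideanLin Dᵀ g with hp
  have hagrad : a = y + p := by
    rw [ha, hp, hg]
    ext i
    simp [Matrix.toLpLin_apply, Matrix.mulVec_sub]
    ring
  have hadj : inner ℝ g (Matrix.toEuclideanLin D (z - y)) = inner ℝ (z - y) p := by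
    rw [hp, ← Matrix.conjTranspose_eq_transpose_of_trivial,
      Matrix.toEuclideanLin_conjTranspose_eq_adjoint, LinearMap.adjoint_inner_right,
      real_inner_comm]
  have hz : x - Matrix.toEuclideanLin D z = g - Matrix.toEuclideanLin D (z - y) := by
    rw [map_sub, hg]
    abel
  have hza : z - a = (z - y) - p := by rw [hagrad]; abel
  have hya : y - a = -p := by rw [hagrad]; abel
  rw [hz, hza, hya, norm_neg, norm_sub_sq_real g, norm_sub_sq_real (z - y), hadj]
  ring

/-- **Strictly monotonic descent of the k-sparse problem.** For `D` with constant column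
squared norm `m/n` and mutual coherence at most `√n/m` (equivalently
`|⟨dᵢ, dⱼ⟩| ≤ 1/√n` for `i ≠ j`), the hard-thresholding iteration
`y_{t+1} = H_k(Dᵀx + (I − DᵀD)y_t)` satisfies, with `L(y) = ½‖x − Dy‖²`,
`L(y_{t+1}) ≤ L(y_t) + ½‖y_{t+1} − a_{t+1}‖² − ½‖y_t − a_{t+1}‖²
  − ((n − (2k−1)√n − m)/(2n))‖y_{t+1} − y_t‖²`, and in particular `L(y_{t+1}) ≤ L(y_t)`
  whenever `(2k−1)√n + m ≤ n`. -/
theorem ksparse_monotonic_descent {d N : ℕ} (m n k : ℕ)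
    (hm : 0 < m) (hn : 0 < n) (hk : 0 < k)
    (D : Matrix (Fin d) (Fin N) ℝ)
    (hcol : ∀ j : Fin N, ∑ i, (D i j)^2 = (m : ℝ) / n)
    (hcoh : ∀ j j' : Fin N, j ≠ j' → |∑ i, D i j * D i j'| ≤ 1 / Real.sqrt n)
    (x : EuclideanSpace ℝ (Fin d))
    (yt yt1 at1 : EuclideanSpace ℝ (Fin N))
    (hytsparse : (Finset.univ.filter (fun i => yt i ≠ 0)).card ≤ k)
    (ha : at1 = Matrix.toEuclideanLin Dᵀ x
        + Matrix.toEuclideanLin (1 - Dᵀ * D) yt)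
    (hyt1sparse : (Finset.univ.filter (fun i => yt1 i ≠ 0)).card ≤ k)
    (hbest : ∀ y : EuclideanSpace ℝ (Fin N),
      (Finset.univ.filter (fun i => y i ≠ 0)).card ≤ k → ‖yt1 - at1‖ ≤ ‖y - at1‖) :
    (1/2) * ‖x - Matrix.toEuclideanLin D yt1‖^2
      ≤ (1/2) * ‖x - Matrix.toEuclideanLin D yt‖^2
        + (1/2) * ‖yt1 - at1‖^2 - (1/2) * ‖yt - at1‖^2
        - ((n - (2 * (k : ℝ) - 1) * Real.sqrt n - m) / (2 * n)) * ‖yt1 - yt‖^2 ∧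
    ((2 * (k : ℝ) - 1) * Real.sqrt n + m ≤ n →
      (1/2) * ‖x - Matrix.toEuclideanLin D yt1‖^2
        ≤ (1/2) * ‖x - Matrix.toEuclideanLin D yt‖^2) := by
  have hmain : (1/2) * ‖x - Matrix.toEuclideanLin D yt1‖^2
      ≤ (1/2) * ‖x - Matrix.toEuclideanLin D yt‖^2
        + (1/2) * ‖yt1 - at1‖^2 - (1/2) * ‖yt - at1‖^2
        - ((n - (2 * (k : ℝ) - 1) * Real.sqrt n - m) / (2 * n)) * ‖yt1 - yt‖^2 := by
    have hsupp : (Finset.univ.filter fun i => (yt1 - yt) i ≠ 0).card ≤ 2 * k :=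
      (card_support_sub_le yt1 yt).trans (by omega)
    have hrip := norm_sq_toEuclideanLin_le_of_coherence D (by positivity) hcol hcoh _ hsupp
    have hn' : (0 : ℝ) < n := by exact_mod_cast hn
    have hcoef : (n - (2 * (k : ℝ) - 1) * Real.sqrt n - m) / (2 * n) =
        1/2 - (1/2) * ((m : ℝ) / n + (((2 * k : ℕ) : ℝ) - 1) * (1 / Real.sqrt n)) := by
      rw [← Real.sqrt_div_self']
      push_cast
      field_simp
      ring
    rw [half_norm_sq_residual_eq D x yt yt1 at1 ha, hcoef]
    linarith
  refine ⟨hmain, fun hcond => ?_⟩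
  have hdist : ‖yt1 - at1‖ ^ 2 ≤ ‖yt - at1‖ ^ 2 := by
    gcongr
    exact hbest yt hytsparse
  have hgain : 0 ≤ ((n - (2 * (k : ℝ) - 1) * Real.sqrt n - m) / (2 * n)) * ‖yt1 - yt‖^2 :=
    mul_nonneg (div_nonneg (by linarith) (by positivity)) (sq_nonneg _)
  linarith
end
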